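/- arXiv:1410.3031 — 2 statements merged into one kernel-verified Lean document; each statement's English description precedes it below -/
import Mathlib

section
/- Let ε > 0, let ψ be a unit vector on a finite index type A, and let ρ_AB be a density matrix on A×B such that F(|ψ⟩⟨ψ|, ρ_A) ≥ 1 − ε, where ρ_A is the marginal of ρ_AB on A. Then there exists a density matrix θ_B on B such that F(|ψ⟩⟨ψ| ⊗ θ_B, ρ_AB) ≥ 1 − ε. -/
open scoped Kronecker BigOperators
open Matrix
open scoped ComplexOrder Classical

noncomputable section

/-- A density matrix: positive semidefinite with unit trace. -/
def IsDensityMatrix {d : Type*} [Fintype d] (ρ : Matrix d d ℂ) : Prop :=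
  ρ.PosSemidef ∧ ρ.trace = 1

/-- Loewner order on Hermitian matrices: `A ≤ B` iff `B - A` is positive semidefinite. -/
def LoewnerLE {d : Type*} [Fintype d] (A B : Matrix d d ℂ) : Prop := (B - A).PosSemidef

/-- Partial trace over the second tensor factor. -/
def ptrace2 {d₁ d₂ : Type*} [Fintype d₂] (M : Matrix (d₁ × d₂) (d₁ × d₂) ℂ) :
    Matrix d₁ d₁ ℂ :=
  fun i i' => ∑ k, M (i, k) (i', k)

/-- Partial trace over the first tensor factor. -/
def ptrace1 {d₁ d₂ : Type*} [Fintype d₁] (M : Matrix (d₁ × d₂) (d₁ × d₂) ℂ) :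
    Matrix d₂ d₂ ℂ :=
  fun j j' => ∑ k, M (k, j) (k, j')

/-- Functional calculus for Hermitian matrices: apply `f` to the eigenvalues. -/
def hermCFC {d : Type*} [Fintype d] [DecidableEq d] (f : ℝ → ℝ) (A : Matrix d d ℂ) :
    Matrix d d ℂ :=
  if hA : A.IsHermitian then
    (hA.eigenvectorUnitary : Matrix d d ℂ) *
      Matrix.diagonal (fun i => (f (hA.eigenvalues i) : ℂ)) *
      (star (hA.eigenvectorUnitary : Matrix d d ℂ))
  else 0

/-- Matrix logarithm, base 2, applied to nonzero eigenvalues. -/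
def matLog2 {d : Type*} [Fintype d] [DecidableEq d] (A : Matrix d d ℂ) : Matrix d d ℂ :=
  hermCFC (Real.logb 2) A

/-- Positive semidefinite square root (via functional calculus). -/
def matSqrt {d : Type*} [Fintype d] [DecidableEq d] (A : Matrix d d ℂ) : Matrix d d ℂ :=
  hermCFC Real.sqrt A

/-- Support containment: the kernel of `σ` is contained in the kernel of `ρ`. -/
def SupportLE {d : Type*} [Fintype d] (ρ σ : Matrix d d ℂ) : Prop :=
  ∀ v : d → ℂ, σ.mulVec v = 0 → ρ.mulVec v = 0

/-- Relative entropy, base 2, as a real number (meaningful when supports are nested). -/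
def relentR {d : Type*} [Fintype d] [DecidableEq d] (ρ σ : Matrix d d ℂ) : ℝ :=
  ((ρ * matLog2 ρ).trace - (ρ * matLog2 σ).trace).re

/-- Relative entropy `D(ρ‖σ)`, base 2, valued in the extended reals: `+∞` unless
the support of `ρ` is contained in the support of `σ`. -/
def relent {d : Type*} [Fintype d] [DecidableEq d] (ρ σ : Matrix d d ℂ) : EReal :=
  if SupportLE ρ σ then ((relentR ρ σ : ℝ) : EReal) else ⊤

/-- Mutual information `I(A:B)_ρ = D(ρ_AB ‖ ρ_A ⊗ ρ_B)`. -/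
def mutInfo {d₁ d₂ : Type*} [Fintype d₁] [Fintype d₂] [DecidableEq d₁] [DecidableEq d₂]
    (ρ : Matrix (d₁ × d₂) (d₁ × d₂) ℂ) : EReal :=
  relent ρ (ptrace2 ρ ⊗ₖ ptrace1 ρ)

/-- Fidelity `F(ρ,σ) = Tr √(√σ ρ √σ)`. -/
def fidelity {d : Type*} [Fintype d] [DecidableEq d] (ρ σ : Matrix d d ℂ) : ℝ :=
  ((matSqrt (matSqrt σ * ρ * matSqrt σ)).trace).re

/-- Purified distance `P(ρ,σ) = √(1 - F(ρ,σ)²)`. -/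
def pdist {d : Type*} [Fintype d] [DecidableEq d] (ρ σ : Matrix d d ℂ) : ℝ :=
  Real.sqrt (1 - (fidelity ρ σ) ^ 2)

/-- Max-relative entropy `Dmax(ρ‖σ) = inf {λ : ρ ≤ 2^λ σ}`, valued in the extended reals. -/
def dmax {d : Type*} [Fintype d] (ρ σ : Matrix d d ℂ) : EReal :=
  sInf {x : EReal | ∃ l : ℝ, x = (l : EReal) ∧ LoewnerLE ρ (((2 : ℝ) ^ l) • σ)}

/-- Max-information `Imax(A:B)_ρ`. -/
def imax {d₁ d₂ : Type*} [Fintype d₁] [Fintype d₂]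
    (ρ : Matrix (d₁ × d₂) (d₁ × d₂) ℂ) : EReal :=
  ⨅ σ : {σ : Matrix d₂ d₂ ℂ // IsDensityMatrix σ}, dmax ρ (ptrace2 ρ ⊗ₖ σ.1)

/-- Smooth max-information `Imax^ε(A:B)_ρ`. -/
def imaxEps {d₁ d₂ : Type*} [Fintype d₁] [Fintype d₂] [DecidableEq d₁] [DecidableEq d₂]
    (ε : ℝ) (ρ : Matrix (d₁ × d₂) (d₁ × d₂) ℂ) : EReal :=
  ⨅ ρ' : {ρ' : Matrix (d₁ × d₂) (d₁ × d₂) ℂ // IsDensityMatrix ρ' ∧ pdist ρ ρ' ≤ ε},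
    imax ρ'.1

/-- The `j`-th term of the convex split: `ρ` on `P` and the `j`-th copy of `Q`, and
`σ` on every other copy of `Q`. -/
def blockState {P Q : Type*} [Fintype Q] [DecidableEq Q]
    (ρ : Matrix (P × Q) (P × Q) ℂ) (σ : Matrix Q Q ℂ) (n : ℕ) (j : Fin n) :
    Matrix (P × (Fin n → Q)) (P × (Fin n → Q)) ℂ :=
  fun x y => ρ (x.1, x.2 j) (y.1, y.2 j) * ∏ i ∈ Finset.univ.erase j, σ (x.2 i) (y.2 i)

/-- The convex-split state `τ = (1/n) Σ_j ρ_{PQ_j} ⊗ σ_{Q_1} ⊗ ⋯ ⊗ σ_{Q_n}` (omitting `j`). -/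
def convexSplit {P Q : Type*} [Fintype Q] [DecidableEq Q]
    (ρ : Matrix (P × Q) (P × Q) ℂ) (σ : Matrix Q Q ℂ) (n : ℕ) :
    Matrix (P × (Fin n → Q)) (P × (Fin n → Q)) ℂ :=
  ((n : ℂ)⁻¹) • ∑ j : Fin n, blockState ρ σ n j

/-- A finite nonempty index type. -/
structure FinIdx where
  carrier : Type
  [fin : Fintype carrier]
  [deq : DecidableEq carrier]
  [ne : Nonempty carrier]

attribute [instance] FinIdx.fin FinIdx.deq FinIdx.ne

section SquareRoot

open scoped MatrixOrder

variable {d : Type*} [Fintype d] [DecidableEq d]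

lemma hermCFC_eq_cfc (f : ℝ → ℝ) {A : Matrix d d ℂ} (hA : A.IsHermitian) :
    hermCFC f A = cfc f A := by
  rw [hA.cfc_eq, hermCFC, dif_pos hA, Matrix.IsHermitian.cfc, Unitary.conjStarAlgAut_apply]
  rfl

lemma matSqrt_eq_cfcSqrt {A : Matrix d d ℂ} (hA : A.PosSemidef) : matSqrt A = CFC.sqrt A := by
  rw [matSqrt, hermCFC_eq_cfc _ hA.isHermitian, CFC.sqrt_eq_real_sqrt A hA.nonneg,
    cfcₙ_eq_cfc]

lemma matSqrt_posSemidef {A : Matrix d d ℂ} (hA : A.PosSemidef) : (matSqrt A).PosSemidef := by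
  rw [matSqrt_eq_cfcSqrt hA]
  exact Matrix.nonneg_iff_posSemidef.mp (CFC.sqrt_nonneg A)

lemma matSqrt_mul_matSqrt {A : Matrix d d ℂ} (hA : A.PosSemidef) :
    matSqrt A * matSqrt A = A := by
  rw [matSqrt_eq_cfcSqrt hA]
  exact CFC.sqrt_mul_sqrt_self A hA.nonneg

lemma matSqrt_mul_self {A : Matrix d d ℂ} (hA : A.PosSemidef) : matSqrt (A * A) = A := by
  have h : (A * A).PosSemidef := by
    simpa [hA.isHermitian.eq] using Matrix.posSemidef_conjTranspose_mul_self A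
  rw [matSqrt_eq_cfcSqrt h]
  exact CFC.sqrt_mul_self A hA.nonneg

end SquareRoot

/-- If compressing `ρ` by `V` yields `p` times the trace-one matrix `θ`, then the fidelity of
`ρ` with `V θ Vᴴ` is `√p`. -/
lemma fidelity_conj_compression {d m : Type*} [Fintype d] [DecidableEq d] [Fintype m]
    {ρ : Matrix d d ℂ} (hρ : ρ.PosSemidef) (V : Matrix d m ℂ) {θ : Matrix m m ℂ}
    (hθ : θ.trace = 1) {p : ℝ} (hp : 0 ≤ p) (h : Vᴴ * ρ * V = p • θ) :
    fidelity (V * θ * Vᴴ) ρ = √p := by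
  obtain ⟨S, hS⟩ : ∃ S, S = matSqrt ρ := ⟨_, rfl⟩
  have hSS : S * S = ρ := hS ▸ matSqrt_mul_matSqrt hρ
  have hSh : Sᴴ = S := hS ▸ (matSqrt_posSemidef hρ).isHermitian.eq
  rw [fidelity, ← hS]
  rcases hp.eq_or_lt with rfl | hp
  · have hSV : S * V = 0 := by
      rw [← Matrix.conjTranspose_mul_self_eq_zero, Matrix.conjTranspose_mul, hSh,
        Matrix.mul_assoc, ← Matrix.mul_assoc S, hSS, ← Matrix.mul_assoc, h, zero_smul]
    have h0 : S * (V * θ * Vᴴ) * S = 0 * 0 := by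
      simp [← Matrix.mul_assoc, hSV]
    rw [h0, matSqrt_mul_self Matrix.PosSemidef.zero]
    simp
  · have hpsd : ((√p)⁻¹ • (S * V * (S * V)ᴴ)).PosSemidef :=
      (Matrix.posSemidef_self_mul_conjTranspose _).smul (by positivity)
    have hsq : S * (V * θ * Vᴴ) * S =
        ((√p)⁻¹ • (S * V * (S * V)ᴴ)) * ((√p)⁻¹ • (S * V * (S * V)ᴴ)) := by
      have hθ' : θ = p⁻¹ • (Vᴴ * ρ * V) := by rw [h, inv_smul_smul₀ hp.ne']
      rw [hθ', smul_mul_smul_comm, ← mul_inv, Real.mul_self_sqrt hp.le,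
        Matrix.conjTranspose_mul, hSh, ← hSS]
      simp [Matrix.mul_assoc]
    rw [hsq, matSqrt_mul_self hpsd, Matrix.trace_smul, Matrix.trace_mul_comm,
      Matrix.conjTranspose_mul, hSh, Matrix.mul_assoc, ← Matrix.mul_assoc S, hSS,
      ← Matrix.mul_assoc, h, Matrix.trace_smul, hθ]
    simp only [Complex.real_smul, mul_one, ← Complex.ofReal_mul, Complex.ofReal_re]
    rw [inv_mul_eq_div, Real.div_sqrt]

lemma exists_isDensityMatrix (B : Type*) [Fintype B] [Nonempty B] :
    ∃ θ : Matrix B B ℂ, IsDensityMatrix θ := by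
  obtain ⟨b⟩ := ‹Nonempty B›
  refine ⟨Matrix.diagonal (Pi.single b 1), Matrix.PosSemidef.diagonal ?_, ?_⟩
  · exact Pi.single_nonneg.mpr zero_le_one
  · simp [Matrix.trace_diagonal]

/-- A positive semidefinite matrix is a nonnegative multiple of a density matrix. -/
lemma Matrix.PosSemidef.exists_eq_smul_isDensityMatrix {B : Type*} [Fintype B] [Nonempty B]
    {M : Matrix B B ℂ} (hM : M.PosSemidef) :
    ∃ p : ℝ, 0 ≤ p ∧ M.trace = p ∧ ∃ θ, IsDensityMatrix θ ∧ M = p • θ := by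
  obtain ⟨hre, him⟩ := Complex.nonneg_iff.mp hM.trace_nonneg
  have htr : M.trace = (M.trace.re : ℂ) := Complex.ext rfl (by simp [← him])
  refine ⟨M.trace.re, hre, htr, ?_⟩
  rcases hre.eq_or_lt with h0 | hpos
  · obtain ⟨θ, hθ⟩ := exists_isDensityMatrix B
    refine ⟨θ, hθ, ?_⟩
    rw [← h0, zero_smul, ← hM.trace_eq_zero_iff, htr, ← h0, Complex.ofReal_zero]
  · refine ⟨M.trace.re⁻¹ • M, ⟨hM.smul (inv_nonneg.mpr hre), ?_⟩, ?_⟩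
    · rw [Matrix.trace_smul, Complex.real_smul, Complex.ofReal_inv, ← htr]
      exact inv_mul_cancel₀ fun h => hpos.ne' (by simp [h])
    · rw [smul_inv_smul₀ hpos.ne']

lemma ptrace2_posSemidef {A B : Type*} [Fintype A] [Fintype B]
    {ρ : Matrix (A × B) (A × B) ℂ} (hρ : ρ.PosSemidef) : (ptrace2 ρ).PosSemidef := by
  have h : ptrace2 ρ = ∑ b, ρ.submatrix (fun a => (a, b)) (fun a => (a, b)) := by
    ext i j
    simp [ptrace2, Matrix.sum_apply]
  rw [h]
  exact Matrix.posSemidef_sum _ fun b _ => hρ.submatrix _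

/-- The operator `|ψ⟩ ⊗ 1` from `B` to `A × B`. -/
def ketTensorOne {A : Type*} (B : Type*) [DecidableEq B] (ψ : A → ℂ) : Matrix (A × B) B ℂ :=
  fun x b => ψ x.1 * (1 : Matrix B B ℂ) x.2 b

lemma ketTensorOne_mul_mul_conjTranspose {A B : Type*} [Fintype B] [DecidableEq B]
    (ψ : A → ℂ) (θ : Matrix B B ℂ) :
    ketTensorOne B ψ * θ * (ketTensorOne B ψ)ᴴ = Matrix.vecMulVec ψ (star ψ) ⊗ₖ θ := by
  ext ⟨a, b⟩ ⟨a', b'⟩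
  simp [ketTensorOne, Matrix.mul_apply, Matrix.one_apply, Matrix.vecMulVec_apply, apply_ite]
  ring

lemma trace_ketTensorOne_compression {A B : Type*} [Fintype A] [Fintype B] [DecidableEq B]
    (ψ : A → ℂ) (ρ : Matrix (A × B) (A × B) ℂ) :
    ((ketTensorOne B ψ)ᴴ * ρ * ketTensorOne B ψ).trace =
      star ψ ⬝ᵥ (ptrace2 ρ *ᵥ ψ) := by
  simp [ketTensorOne, Matrix.trace, Matrix.mul_apply, Matrix.one_apply, Fintype.sum_prod_type,
    ptrace2, dotProduct, Matrix.mulVec, apply_ite, Finset.sum_mul, Finset.mul_sum]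
  simp_rw [mul_assoc]
  rw [Finset.sum_comm]
  conv_rhs => rw [Finset.sum_comm]
  exact Finset.sum_congr rfl fun _ _ => Finset.sum_comm

/-- If ρ_AB has marginal close in fidelity to a pure state ψ on A, then ρ_AB is close
in fidelity to ψ ⊗ θ for some density matrix θ on B. -/
theorem pure_marginal_close {A B : Type} [Fintype A] [Fintype B]
    [DecidableEq A] [DecidableEq B] [Nonempty A] [Nonempty B]
    (ε : ℝ) (hε : 0 < ε)
    (ψ : A → ℂ) (hψ : ∑ i, ‖ψ i‖ ^ 2 = 1)
    (ρ : Matrix (A × B) (A × B) ℂ) (hρ : IsDensityMatrix ρ)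
    (hF : fidelity (Matrix.vecMulVec ψ (star ψ)) (ptrace2 ρ) ≥ 1 - ε) :
    ∃ θ : Matrix B B ℂ, IsDensityMatrix θ ∧
      fidelity (Matrix.vecMulVec ψ (star ψ) ⊗ₖ θ) ρ ≥ 1 - ε := by
  obtain ⟨p, hp, htr, θ, hθ, hM⟩ :=
    (hρ.1.conjTranspose_mul_mul_same (ketTensorOne B ψ)).exists_eq_smul_isDensityMatrix
  refine ⟨θ, hθ, ?_⟩
  have hAB := fidelity_conj_compression hρ.1 (ketTensorOne B ψ) hθ.2 hp hM
  have hA := fidelity_conj_compression (ptrace2_posSemidef hρ.1)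
    (Matrix.replicateCol Unit ψ) (θ := 1) (by simp) hp (by
      ext
      rw [trace_ketTensorOne_compression] at htr
      rw [Matrix.mul_assoc, ← Matrix.replicateCol_mulVec, Matrix.conjTranspose_replicateCol,
        Matrix.replicateRow_mul_replicateCol_apply, htr]
      simp)
  rw [Matrix.mul_one, Matrix.conjTranspose_replicateCol, ← Matrix.vecMulVec_eq] at hA
  rw [ketTensorOne_mul_mul_conjTranspose] at hAB
  rwa [hAB, ← hA]

end
end

section
/- Let ρ_PQ be a density matrix on P×Q and σ_Q a density matrix on Q such that Dmax(ρ_PQ ‖ ρ_P ⊗ σ_Q) is finite. Then I(P:Q)_ρ ≤ Dmax(ρ_PQ ‖ ρ_P ⊗ σ_Q). -/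
open scoped Kronecker BigOperators
open Matrix
open scoped ComplexOrder Classical

noncomputable section

/-- The diagonal complex matrix with the given real entries. -/
abbrev realDiag {d : Type*} [DecidableEq d] (a : d → ℝ) : Matrix d d ℂ :=
  Matrix.diagonal fun i => (a i : ℂ)

section Diagonalization

variable {d : Type*} [Fintype d] [DecidableEq d]

lemma Matrix.IsHermitian.exists_eq_conj_realDiag {A : Matrix d d ℂ} (hA : A.IsHermitian) :
    ∃ U ∈ unitary (Matrix d d ℂ), ∃ a : d → ℝ, A = U * realDiag a * Uᴴ :=
  ⟨hA.eigenvectorUnitary, hA.eigenvectorUnitary.2, hA.eigenvalues, by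
    conv_lhs => rw [hA.spectral_theorem, Unitary.conjStarAlgAut_apply]
    rfl⟩

lemma conjTranspose_mul_self_of_mem_unitary {U : Matrix d d ℂ}
    (hU : U ∈ unitary (Matrix d d ℂ)) : Uᴴ * U = 1 :=
  Unitary.star_mul_self_of_mem hU

lemma mul_conjTranspose_self_of_mem_unitary {U : Matrix d d ℂ}
    (hU : U ∈ unitary (Matrix d d ℂ)) : U * Uᴴ = 1 :=
  Unitary.mul_star_self_of_mem hU

lemma one_eq_conj_realDiag {U : Matrix d d ℂ} (hU : U ∈ unitary (Matrix d d ℂ)) :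
    (1 : Matrix d d ℂ) = U * realDiag (fun _ => 1) * Uᴴ := by
  simp [realDiag, mul_conjTranspose_self_of_mem_unitary hU]

lemma isHermitian_conj_realDiag (U : Matrix d d ℂ) (a : d → ℝ) :
    (U * realDiag a * Uᴴ).IsHermitian := by
  refine Matrix.isHermitian_mul_mul_conjTranspose U ?_
  rw [Matrix.IsHermitian, Matrix.diagonal_conjTranspose]
  congr 1
  ext i
  simp

lemma conjTranspose_mul_conj_mul {U : Matrix d d ℂ} (hU : U ∈ unitary (Matrix d d ℂ))
    (D : Matrix d d ℂ) : Uᴴ * (U * D * Uᴴ) * U = D := by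
  have h := conjTranspose_mul_self_of_mem_unitary hU
  calc Uᴴ * (U * D * Uᴴ) * U = (Uᴴ * U) * D * (Uᴴ * U) := by simp only [Matrix.mul_assoc]
    _ = D := by simp [h]

/-- The functional calculus may be computed in any unitary diagonalization. -/
lemma hermCFC_conj_realDiag (f : ℝ → ℝ) {U : Matrix d d ℂ} (hU : U ∈ unitary (Matrix d d ℂ))
    (a : d → ℝ) : hermCFC f (U * realDiag a * Uᴴ) = U * realDiag (f ∘ a) * Uᴴ := by
  have hA := isHermitian_conj_realDiag U a
  have key : ∃ V ∈ unitary (Matrix d d ℂ), ∃ b : d → ℝ, U * realDiag a * Uᴴ = V * realDiag b * Vᴴ ∧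
      hermCFC f (U * realDiag a * Uᴴ) = V * realDiag (f ∘ b) * Vᴴ := by
    refine ⟨hA.eigenvectorUnitary, hA.eigenvectorUnitary.2, hA.eigenvalues, ?_, ?_⟩
    · conv_lhs => rw [hA.spectral_theorem, Unitary.conjStarAlgAut_apply]
      rfl
    · rw [hermCFC, dif_pos hA]
      rfl
  obtain ⟨V, hV, b, hab, hf⟩ := key
  rw [hf]
  have hU1 := conjTranspose_mul_self_of_mem_unitary hU
  have hU2 := mul_conjTranspose_self_of_mem_unitary hU
  have hV1 := conjTranspose_mul_self_of_mem_unitary hV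
  have hV2 := mul_conjTranspose_self_of_mem_unitary hV
  have h1 : (Vᴴ * U) * realDiag a = realDiag b * (Vᴴ * U) := by
    calc (Vᴴ * U) * realDiag a = Vᴴ * (U * realDiag a * Uᴴ) * U := by
          simp only [Matrix.mul_assoc, hU1, Matrix.mul_one]
      _ = (Vᴴ * V) * realDiag b * (Vᴴ * U) := by rw [hab]; simp only [Matrix.mul_assoc]
      _ = realDiag b * (Vᴴ * U) := by rw [hV1, Matrix.one_mul]
  have h2 : (Vᴴ * U) * realDiag (f ∘ a) = realDiag (f ∘ b) * (Vᴴ * U) := by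
    ext i j
    have h := congrFun (congrFun h1 i) j
    rw [Matrix.mul_diagonal, Matrix.diagonal_mul, mul_comm] at h ⊢
    by_cases h0 : (Vᴴ * U) i j = 0
    · simp [h0]
    · have : a j = b i := by exact_mod_cast mul_right_cancel₀ h0 h
      simp [this]
  calc V * realDiag (f ∘ b) * Vᴴ = V * (realDiag (f ∘ b) * (Vᴴ * U)) * Uᴴ := by
        simp only [Matrix.mul_assoc, hU2, Matrix.mul_one]
    _ = (V * Vᴴ) * U * realDiag (f ∘ a) * Uᴴ := by rw [← h2]; simp only [Matrix.mul_assoc]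
    _ = U * realDiag (f ∘ a) * Uᴴ := by rw [hV2, Matrix.one_mul]

lemma nonneg_of_posSemidef_conj_realDiag {U : Matrix d d ℂ} (hU : U ∈ unitary (Matrix d d ℂ))
    {a : d → ℝ} (h : (U * realDiag a * Uᴴ).PosSemidef) (i : d) : 0 ≤ a i := by
  have h1 := (h.conjTranspose_mul_mul_same U).diag_nonneg (i := i)
  rw [conjTranspose_mul_conj_mul hU, realDiag, Matrix.diagonal_apply_eq] at h1
  exact_mod_cast h1

lemma trace_conj_realDiag {U : Matrix d d ℂ} (hU : U ∈ unitary (Matrix d d ℂ)) (a : d → ℝ) :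
    (U * realDiag a * Uᴴ).trace = ((∑ i, a i : ℝ) : ℂ) := by
  rw [Matrix.trace_mul_comm, ← Matrix.mul_assoc, conjTranspose_mul_self_of_mem_unitary hU,
    Matrix.one_mul, Matrix.trace_diagonal]
  simp

lemma trace_mul_conj_realDiag (T U : Matrix d d ℂ) (a : d → ℝ) :
    (T * (U * realDiag a * Uᴴ)).trace = ∑ i, (Uᴴ * T * U) i i * a i := by
  have : (T * (U * realDiag a * Uᴴ)).trace = ((Uᴴ * T * U) * realDiag a).trace := by
    rw [← Matrix.mul_assoc, Matrix.trace_mul_comm]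
    simp only [Matrix.mul_assoc]
  rw [this]
  simp [Matrix.trace, Matrix.mul_diagonal]

/-- The matrix of transition probabilities between two orthonormal bases. -/
def overlap {d : Type*} [Fintype d] (U V : Matrix d d ℂ) (i j : d) : ℝ := Complex.normSq ((Vᴴ * U) j i)

lemma overlap_nonneg {d : Type*} [Fintype d] (U V : Matrix d d ℂ) (i j : d) : 0 ≤ overlap U V i j :=
  Complex.normSq_nonneg _

lemma overlap_comm {d : Type*} [Fintype d] (U V : Matrix d d ℂ) (i j : d) : overlap U V i j = overlap V U j i := by
  have : Uᴴ * V = (Vᴴ * U)ᴴ := by simp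
  simp only [overlap, this, Matrix.conjTranspose_apply]
  exact (Complex.normSq_conj _).symm

lemma sum_overlap {U V : Matrix d d ℂ} (hU : U ∈ unitary (Matrix d d ℂ))
    (hV : V ∈ unitary (Matrix d d ℂ)) (i : d) : ∑ j, overlap U V i j = 1 := by
  have h : (Vᴴ * U)ᴴ * (Vᴴ * U) = 1 := by
    calc (Vᴴ * U)ᴴ * (Vᴴ * U) = Uᴴ * (V * Vᴴ) * U := by
          simp [Matrix.mul_assoc]
      _ = 1 := by
          rw [mul_conjTranspose_self_of_mem_unitary hV, Matrix.mul_one,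
            conjTranspose_mul_self_of_mem_unitary hU]
  have h' := congrFun (congrFun h i) i
  rw [Matrix.mul_apply, Matrix.one_apply_eq] at h'
  have : ((∑ j, overlap U V i j : ℝ) : ℂ) = 1 := by
    rw [← h', Complex.ofReal_sum]
    refine Finset.sum_congr rfl fun j _ => ?_
    rw [overlap, Complex.normSq_eq_conj_mul_self]
    rfl
  exact_mod_cast this

lemma sum_overlap_left {U V : Matrix d d ℂ} (hU : U ∈ unitary (Matrix d d ℂ))
    (hV : V ∈ unitary (Matrix d d ℂ)) (j : d) : ∑ i, overlap U V i j = 1 := by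
  simp_rw [overlap_comm U V]
  exact sum_overlap hV hU j

lemma conj_realDiag_diag (U V : Matrix d d ℂ) (p : d → ℝ) (j : d) :
    (Vᴴ * (U * realDiag p * Uᴴ) * V) j j = ((∑ i, p i * overlap U V i j : ℝ) : ℂ) := by
  have : Vᴴ * (U * realDiag p * Uᴴ) * V = (Vᴴ * U) * realDiag p * (Vᴴ * U)ᴴ := by
    simp [Matrix.mul_assoc]
  rw [this, Matrix.mul_apply, Complex.ofReal_sum]
  refine Finset.sum_congr rfl fun i _ => ?_
  rw [Matrix.mul_diagonal, Matrix.conjTranspose_apply, overlap, Complex.ofReal_mul,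
    ← Complex.mul_conj]
  simp only [RCLike.star_def]
  ring

/-- The relative entropy in terms of spectra and transition probabilities. -/
lemma relentR_conj_realDiag {U V : Matrix d d ℂ} (hU : U ∈ unitary (Matrix d d ℂ))
    (hV : V ∈ unitary (Matrix d d ℂ)) (p q : d → ℝ) :
    relentR (U * realDiag p * Uᴴ) (V * realDiag q * Vᴴ) =
      ∑ i, ∑ j, p i * overlap U V i j * (Real.logb 2 (p i) - Real.logb 2 (q j)) := by
  rw [relentR, matLog2, matLog2, hermCFC_conj_realDiag _ hU, hermCFC_conj_realDiag _ hV,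
    trace_mul_conj_realDiag, trace_mul_conj_realDiag, conjTranspose_mul_conj_mul hU]
  simp_rw [conj_realDiag_diag, Matrix.diagonal_apply_eq, Function.comp_apply,
    ← Complex.ofReal_mul, ← Complex.ofReal_sum, ← Complex.ofReal_sub, Complex.ofReal_re,
    mul_sub, Finset.sum_sub_distrib]
  congr 1
  · refine Finset.sum_congr rfl fun i _ => ?_
    rw [← Finset.sum_mul, ← Finset.mul_sum, sum_overlap hU hV, mul_one]
  · rw [Finset.sum_comm]
    simp_rw [Finset.sum_mul]

lemma supportLE_conj_realDiag_iff {T V : Matrix d d ℂ} (hT : T.PosSemidef)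
    (hV : V ∈ unitary (Matrix d d ℂ)) (q : d → ℝ) :
    SupportLE T (V * realDiag q * Vᴴ) ↔ ∀ j, q j = 0 → (Vᴴ * T * V) j j = 0 := by
  have hV1 := conjTranspose_mul_self_of_mem_unitary hV
  have hV2 := mul_conjTranspose_self_of_mem_unitary hV
  constructor
  · intro h j hj
    have h1 : (V * realDiag q * Vᴴ) *ᵥ (V *ᵥ Pi.single j 1) = 0 := by
      rw [Matrix.mulVec_mulVec, Matrix.mul_assoc, hV1, Matrix.mul_one, ← Matrix.mulVec_mulVec]
      have : realDiag q *ᵥ Pi.single j 1 = 0 := by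
        ext k
        by_cases hk : k = j
        · subst hk; simp [Matrix.mulVec_diagonal, hj]
        · simp [Matrix.mulVec_diagonal, hk]
      rw [this, Matrix.mulVec_zero]
    have h2 := h _ h1
    rw [Matrix.mulVec_mulVec] at h2
    have h3 : (Vᴴ * T * V) *ᵥ Pi.single j 1 = 0 := by
      rw [Matrix.mul_assoc, ← Matrix.mulVec_mulVec, h2, Matrix.mulVec_zero]
    simpa using congrFun h3 j
  · intro h v hv
    have hN := hT.conjTranspose_mul_mul_same V
    have hw : ∀ j, q j * (Vᴴ *ᵥ v) j = 0 := by
      intro j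
      have : realDiag q *ᵥ (Vᴴ *ᵥ v) = 0 := by
        calc realDiag q *ᵥ (Vᴴ *ᵥ v) = Vᴴ *ᵥ ((V * realDiag q * Vᴴ) *ᵥ v) := by
              simp only [Matrix.mulVec_mulVec, ← Matrix.mul_assoc, hV1, Matrix.one_mul]
          _ = 0 := by rw [hv, Matrix.mulVec_zero]
      simpa [Matrix.mulVec_diagonal] using congrFun this j
    have hz : (Vᴴ * T * V) *ᵥ (Vᴴ *ᵥ v) = 0 := by
      ext k
      rw [Matrix.mulVec, dotProduct]
      refine Finset.sum_eq_zero fun j _ => ?_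
      by_cases hj : q j = 0
      · have h0 : (Vᴴ * T * V) *ᵥ Pi.single j 1 = 0 := by
          rw [← hN.dotProduct_mulVec_zero_iff]
          simp [h j hj]
        have := congrFun h0 k
        simp at this
        simp [this]
      · have := (mul_eq_zero.mp (hw j)).resolve_left (by exact_mod_cast hj)
        simp [this]
    calc T *ᵥ v = V *ᵥ ((Vᴴ * T * V) *ᵥ (Vᴴ *ᵥ v)) := by
          have : V * (Vᴴ * T * V * Vᴴ) = T := by
            calc V * (Vᴴ * T * V * Vᴴ) = (V * Vᴴ) * T * (V * Vᴴ) := by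
                  simp only [Matrix.mul_assoc]
              _ = T := by simp [hV2]
          simp only [Matrix.mulVec_mulVec, this]
      _ = 0 := by rw [hz, Matrix.mulVec_zero]

end Diagonalization

section RelativeEntropy

variable {d : Type*} [Fintype d] [DecidableEq d]

lemma overlap_eq_zero_of_supportLE {U V : Matrix d d ℂ} (hU : U ∈ unitary (Matrix d d ℂ))
    (hV : V ∈ unitary (Matrix d d ℂ)) {p q : d → ℝ} (hρ : (U * realDiag p * Uᴴ).PosSemidef)
    (hs : SupportLE (U * realDiag p * Uᴴ) (V * realDiag q * Vᴴ)) (i : d) {j : d}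
    (hj : q j = 0) : p i * overlap U V i j = 0 := by
  have h := (supportLE_conj_realDiag_iff hρ hV q).mp hs j hj
  rw [conj_realDiag_diag] at h
  have h' : ∑ i, p i * overlap U V i j = 0 := by exact_mod_cast h
  exact (Finset.sum_eq_zero_iff_of_nonneg fun k _ =>
    mul_nonneg (nonneg_of_posSemidef_conj_realDiag hU hρ k) (overlap_nonneg _ _ _ _)).mp h' i
    (Finset.mem_univ i)

lemma one_sub_inv_le_mul_log {x : ℝ} (hx : 0 < x) : 1 - x⁻¹ ≤ Real.log 2 * Real.logb 2 x := by
  have : Real.log 2 * Real.logb 2 x = Real.log x := by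
    rw [Real.logb]; field_simp
  rw [this]
  exact Real.one_sub_inv_le_log_of_pos hx

/-- Klein's inequality. -/
lemma relentR_nonneg {ρ σ : Matrix d d ℂ} (hρ : IsDensityMatrix ρ) (hσ : IsDensityMatrix σ)
    (hs : SupportLE ρ σ) : 0 ≤ relentR ρ σ := by
  obtain ⟨U, hU, p, rfl⟩ := hρ.1.isHermitian.exists_eq_conj_realDiag
  obtain ⟨V, hV, q, rfl⟩ := hσ.1.isHermitian.exists_eq_conj_realDiag
  have hp := nonneg_of_posSemidef_conj_realDiag hU hρ.1
  have hq := nonneg_of_posSemidef_conj_realDiag hV hσ.1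
  have hp1 : ∑ i, p i = 1 := by
    have := hρ.2; rw [trace_conj_realDiag hU] at this; exact_mod_cast this
  have hq1 : ∑ i, q i = 1 := by
    have := hσ.2; rw [trace_conj_realDiag hV] at this; exact_mod_cast this
  rw [relentR_conj_realDiag hU hV]
  refine nonneg_of_mul_nonneg_right (a := Real.log 2) ?_ (Real.log_pos one_lt_two)
  have hterm : ∀ i j, overlap U V i j * p i - overlap U V i j * q j ≤
      Real.log 2 * (p i * overlap U V i j * (Real.logb 2 (p i) - Real.logb 2 (q j))) := by
    intro i j
    have hW := overlap_nonneg U V i j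
    rcases (hp i).eq_or_lt with h | h
    · have := mul_nonneg hW (hq j)
      simp [← h, this]
    rcases (hq j).eq_or_lt with h' | h'
    · have := overlap_eq_zero_of_supportLE hU hV hρ.1 hs i h'.symm
      simp [this, ← h', mul_comm (overlap U V i j)]
    · have := one_sub_inv_le_mul_log (div_pos h h')
      rw [Real.logb_div h.ne' h'.ne'] at this
      calc overlap U V i j * p i - overlap U V i j * q j
          = p i * overlap U V i j * (1 - (p i / q j)⁻¹) := by field_simp
        _ ≤ p i * overlap U V i j * (Real.log 2 * (Real.logb 2 (p i) - Real.logb 2 (q j))) := by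
            gcongr
        _ = _ := by ring
  have h0 : ∑ i, ∑ j, (overlap U V i j * p i - overlap U V i j * q j) = 0 := by
    simp_rw [Finset.sum_sub_distrib]
    rw [Finset.sum_comm (f := fun i j => overlap U V i j * q j)]
    simp_rw [← Finset.sum_mul, sum_overlap hU hV, sum_overlap_left hU hV, one_mul, hp1, hq1,
      sub_self]
  rw [Finset.mul_sum, ← h0]
  refine Finset.sum_le_sum fun i _ => ?_
  rw [Finset.mul_sum]
  exact Finset.sum_le_sum fun j _ => hterm i j

lemma LoewnerLE.supportLE {d : Type*} [Fintype d] {ρ τ : Matrix d d ℂ} (hρ : ρ.PosSemidef) {c : ℝ}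
    (h : LoewnerLE ρ (c • τ)) : SupportLE ρ τ := by
  intro v hv
  rw [← hρ.dotProduct_mulVec_zero_iff]
  refine le_antisymm ?_ (hρ.dotProduct_mulVec_nonneg v)
  have h1 := h.dotProduct_mulVec_nonneg v
  rw [Matrix.sub_mulVec, Matrix.smul_mulVec, hv, smul_zero, zero_sub, dotProduct_neg] at h1
  exact neg_nonneg.mp h1

/-- If `ρ ≤ c • τ`, then `⟨u, τ⁻¹ u⟩ ≤ c / p` for each unit eigenvector `u` of `ρ` with positive
eigenvalue `p`, where `τ⁻¹` is the pseudo-inverse. -/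
lemma LoewnerLE.mul_sum_overlap_div_le {U V : Matrix d d ℂ} (hV : V ∈ unitary (Matrix d d ℂ))
    {p q : d → ℝ} (hp : ∀ i, 0 ≤ p i) (hq : ∀ i, 0 ≤ q i) {c : ℝ} (hc : 0 ≤ c)
    (h : LoewnerLE (U * realDiag p * Uᴴ) (c • (V * realDiag q * Vᴴ))) (i : d) :
    p i * ∑ j, overlap U V i j * (q j)⁻¹ ≤ c := by
  set M := Vᴴ * U with hM
  set S := ∑ j, overlap U V i j * (q j)⁻¹ with hS
  have hS0 : 0 ≤ S := Finset.sum_nonneg fun j _ =>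
    mul_nonneg (overlap_nonneg _ _ _ _) (inv_nonneg.mpr (hq j))
  set w : d → ℂ := fun j => M j i * ((q j)⁻¹ : ℝ) with hw
  have h1 := (h.conjTranspose_mul_mul_same V).dotProduct_mulVec_nonneg w
  have hN : Vᴴ * (c • (V * realDiag q * Vᴴ) - U * realDiag p * Uᴴ) * V =
      c • realDiag q - M * realDiag p * Mᴴ := by
    rw [Matrix.mul_sub, Matrix.sub_mul, Matrix.mul_smul, Matrix.smul_mul,
      conjTranspose_mul_conj_mul hV, hM]
    simp [Matrix.mul_assoc]
  rw [hN, Matrix.sub_mulVec, dotProduct_sub, Matrix.smul_mulVec, dotProduct_smul] at h1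
  have hA : star w ⬝ᵥ realDiag q *ᵥ w = (S : ℂ) := by
    rw [dotProduct, hS, Complex.ofReal_sum]
    refine Finset.sum_congr rfl fun j _ => ?_
    rw [Matrix.mulVec_diagonal, overlap, ← hM, Complex.ofReal_mul, ← Complex.mul_conj]
    simp only [hw, Pi.star_apply, RCLike.star_def, map_mul, Complex.conj_ofReal]
    by_cases hj : q j = 0
    · simp [hj]
    · have : (q j : ℂ) ≠ 0 := by exact_mod_cast hj
      push_cast
      field_simp
  have hB : star w ⬝ᵥ (M * realDiag p * Mᴴ) *ᵥ w =
      ((∑ k, p k * Complex.normSq ((Mᴴ *ᵥ w) k) : ℝ) : ℂ) := by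
    have : star w ⬝ᵥ (M * realDiag p * Mᴴ) *ᵥ w =
        star (Mᴴ *ᵥ w) ⬝ᵥ realDiag p *ᵥ (Mᴴ *ᵥ w) := by
      rw [Matrix.star_mulVec, Matrix.conjTranspose_conjTranspose, ← Matrix.dotProduct_mulVec,
        Matrix.mulVec_mulVec, Matrix.mulVec_mulVec, Matrix.mul_assoc]
    rw [this, dotProduct, Complex.ofReal_sum]
    refine Finset.sum_congr rfl fun k _ => ?_
    rw [Matrix.mulVec_diagonal, Complex.ofReal_mul, ← Complex.mul_conj]
    simp only [Pi.star_apply, RCLike.star_def]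
    ring
  have hC : (Mᴴ *ᵥ w) i = (S : ℂ) := by
    rw [Matrix.mulVec, dotProduct, hS, Complex.ofReal_sum]
    refine Finset.sum_congr rfl fun j _ => ?_
    rw [overlap, ← hM, Complex.ofReal_mul, ← Complex.mul_conj]
    simp only [hw, Matrix.conjTranspose_apply, RCLike.star_def]
    ring
  rw [hA, hB, Complex.real_smul, ← Complex.ofReal_mul, ← Complex.ofReal_sub] at h1
  have h2 : 0 ≤ c * S - ∑ k, p k * Complex.normSq ((Mᴴ *ᵥ w) k) := by exact_mod_cast h1
  have h3 : p i * (S * S) ≤ ∑ k, p k * Complex.normSq ((Mᴴ *ᵥ w) k) := by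
    have := Finset.single_le_sum (f := fun k => p k * Complex.normSq ((Mᴴ *ᵥ w) k))
      (fun k _ => mul_nonneg (hp k) (Complex.normSq_nonneg _)) (Finset.mem_univ i)
    simpa [hC, Complex.normSq_ofReal] using this
  rcases hS0.eq_or_lt with h0 | h0
  · rw [← h0, mul_zero]; exact hc
  · refine le_of_mul_le_mul_right ?_ h0
    linarith

/-- The relative entropy is at most the max-relative entropy. -/
lemma relentR_le_of_loewnerLE {ρ τ : Matrix d d ℂ} (hρ : IsDensityMatrix ρ) (hτ : τ.PosSemidef)
    {l : ℝ} (h : LoewnerLE ρ ((2 : ℝ) ^ l • τ)) : relentR ρ τ ≤ l := by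
  have hs := h.supportLE hρ.1
  obtain ⟨U, hU, p, rfl⟩ := hρ.1.isHermitian.exists_eq_conj_realDiag
  obtain ⟨V, hV, q, rfl⟩ := hτ.isHermitian.exists_eq_conj_realDiag
  have hp := nonneg_of_posSemidef_conj_realDiag hU hρ.1
  have hq := nonneg_of_posSemidef_conj_realDiag hV hτ
  have hp1 : ∑ i, p i = 1 := by
    have := hρ.2; rw [trace_conj_realDiag hU] at this; exact_mod_cast this
  set c : ℝ := (2 : ℝ) ^ l with hcdef
  have hc : 0 < c := Real.rpow_pos_of_pos two_pos l
  have hlc : Real.logb 2 c = l := Real.logb_rpow two_pos (by norm_num)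
  rw [relentR_conj_realDiag hU hV]
  have hterm : ∀ i j, p i * overlap U V i j * (1 - p i / c * (q j)⁻¹) ≤
      Real.log 2 * (p i * overlap U V i j * (l - (Real.logb 2 (p i) - Real.logb 2 (q j)))) := by
    intro i j
    rcases (hp i).eq_or_lt with h | h
    · simp [← h]
    rcases (hq j).eq_or_lt with h' | h'
    · simp [overlap_eq_zero_of_supportLE hU hV hρ.1 hs i h'.symm]
    · have := one_sub_inv_le_mul_log (div_pos (mul_pos hc h') h)
      rw [Real.logb_div (mul_pos hc h').ne' h.ne', Real.logb_mul hc.ne' h'.ne', hlc] at this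
      calc p i * overlap U V i j * (1 - p i / c * (q j)⁻¹)
          = p i * overlap U V i j * (1 - (c * q j / p i)⁻¹) := by
            congr 2; field_simp
        _ ≤ p i * overlap U V i j * (Real.log 2 * (l + Real.logb 2 (q j) - Real.logb 2 (p i))) := by
            gcongr
            exact mul_nonneg h.le (overlap_nonneg _ _ _ _)
        _ = _ := by ring
  have hrow : ∀ i, 0 ≤ ∑ j, p i * overlap U V i j * (1 - p i / c * (q j)⁻¹) := by
    intro i
    have h1 := h.mul_sum_overlap_div_le hV hp hq hc.le i
    have h2 : ∑ j, p i * overlap U V i j * (1 - p i / c * (q j)⁻¹) =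
        p i * (1 - (p i * ∑ j, overlap U V i j * (q j)⁻¹) / c) := by
      conv_rhs => rw [← sum_overlap hU hV i, Finset.mul_sum, Finset.sum_div,
        ← Finset.sum_sub_distrib, Finset.mul_sum]
      refine Finset.sum_congr rfl fun j _ => ?_
      ring
    rw [h2]
    exact mul_nonneg (hp i) (sub_nonneg.mpr ((div_le_one hc).mpr h1))
  have hl : ∑ i, ∑ j, p i * overlap U V i j * l = l := by
    simp_rw [← Finset.sum_mul, ← Finset.mul_sum, sum_overlap hU hV, mul_one, hp1, one_mul]
  rw [← sub_nonneg]
  refine nonneg_of_mul_nonneg_right (a := Real.log 2) ?_ (Real.log_pos one_lt_two)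
  calc 0 ≤ ∑ i, ∑ j, p i * overlap U V i j * (1 - p i / c * (q j)⁻¹) :=
        Finset.sum_nonneg fun i _ => hrow i
    _ ≤ ∑ i, ∑ j, Real.log 2 *
          (p i * overlap U V i j * (l - (Real.logb 2 (p i) - Real.logb 2 (q j)))) :=
        Finset.sum_le_sum fun i _ => Finset.sum_le_sum fun j _ => hterm i j
    _ = _ := by
        conv_rhs => rw [← hl]
        simp_rw [mul_sub _ l, mul_sub (Real.log 2), Finset.sum_sub_distrib, Finset.mul_sum]

end RelativeEntropy

section PartialTrace

variable {P Q : Type*} [Fintype P] [Fintype Q]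

lemma ptrace1_eq_sum_submatrix {P Q : Type*} [Fintype P] (M : Matrix (P × Q) (P × Q) ℂ) :
    ptrace1 M = ∑ k, M.submatrix (Prod.mk k) (Prod.mk k) := by
  ext i j
  simp [ptrace1, Matrix.sum_apply]

lemma ptrace2_eq_sum_submatrix {P Q : Type*} [Fintype Q] (M : Matrix (P × Q) (P × Q) ℂ) :
    ptrace2 M = ∑ k, M.submatrix (fun i => (i, k)) (fun i => (i, k)) := by
  ext i j
  simp [ptrace2, Matrix.sum_apply]

lemma Matrix.PosSemidef.ptrace1 {P Q : Type*} [Fintype P] {M : Matrix (P × Q) (P × Q) ℂ} (hM : M.PosSemidef) :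
    (_root_.ptrace1 M).PosSemidef := by
  rw [ptrace1_eq_sum_submatrix]
  exact Matrix.posSemidef_sum _ fun k _ => hM.submatrix _

lemma Matrix.PosSemidef.ptrace2 {P Q : Type*} [Fintype Q] {M : Matrix (P × Q) (P × Q) ℂ} (hM : M.PosSemidef) :
    (_root_.ptrace2 M).PosSemidef := by
  rw [ptrace2_eq_sum_submatrix]
  exact Matrix.posSemidef_sum _ fun k _ => hM.submatrix _

lemma IsDensityMatrix.ptrace1 {ρ : Matrix (P × Q) (P × Q) ℂ} (hρ : IsDensityMatrix ρ) :
    IsDensityMatrix (_root_.ptrace1 ρ) := by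
  refine ⟨hρ.1.ptrace1, ?_⟩
  rw [← hρ.2]
  simp only [Matrix.trace, _root_.ptrace1, Matrix.diag_apply, Fintype.sum_prod_type]
  exact Finset.sum_comm

lemma trace_mul_kronecker_one [DecidableEq Q] (M : Matrix (P × Q) (P × Q) ℂ) (X : Matrix P P ℂ) :
    (M * (X ⊗ₖ (1 : Matrix Q Q ℂ))).trace = (ptrace2 M * X).trace := by
  simp only [Matrix.trace, Matrix.diag_apply, Matrix.mul_apply, Fintype.sum_prod_type,
    Matrix.kroneckerMap_apply, Matrix.one_apply, ptrace2, mul_ite, mul_one, mul_zero,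
    Finset.sum_ite_eq', Finset.mem_univ, if_true, Finset.sum_mul]
  exact Finset.sum_congr rfl fun i _ => Finset.sum_comm

lemma trace_mul_one_kronecker [DecidableEq P] (M : Matrix (P × Q) (P × Q) ℂ) (Y : Matrix Q Q ℂ) :
    (M * ((1 : Matrix P P ℂ) ⊗ₖ Y)).trace = (ptrace1 M * Y).trace := by
  simp only [Matrix.trace, Matrix.diag_apply, Matrix.mul_apply, Fintype.sum_prod_type_right,
    Matrix.kroneckerMap_apply, Matrix.one_apply, ptrace1, ite_mul, one_mul, zero_mul, mul_ite,
    mul_zero, Finset.sum_ite_eq', Finset.mem_univ, if_true, Finset.sum_mul]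
  exact Finset.sum_congr rfl fun i _ => Finset.sum_comm

variable [DecidableEq P] [DecidableEq Q]

lemma kronecker_conj_realDiag (U : Matrix P P ℂ) (V : Matrix Q Q ℂ) (a : P → ℝ) (b : Q → ℝ) :
    (U * realDiag a * Uᴴ) ⊗ₖ (V * realDiag b * Vᴴ) =
      (U ⊗ₖ V) * realDiag (fun x : P × Q => a x.1 * b x.2) * (U ⊗ₖ V)ᴴ := by
  rw [Matrix.conjTranspose_kronecker, Matrix.mul_kronecker_mul, Matrix.mul_kronecker_mul,
    Matrix.diagonal_kronecker_diagonal]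
  simp [realDiag]

/-- On states supported in `A ⊗ B`, the logarithm of `A ⊗ B` is additive. -/
lemma trace_mul_matLog2_kronecker {ρ : Matrix (P × Q) (P × Q) ℂ} (hρ : ρ.PosSemidef)
    {A : Matrix P P ℂ} {B : Matrix Q Q ℂ} (hA : A.IsHermitian) (hB : B.IsHermitian)
    (hs : SupportLE ρ (A ⊗ₖ B)) :
    (ρ * matLog2 (A ⊗ₖ B)).trace =
      (ptrace2 ρ * matLog2 A).trace + (ptrace1 ρ * matLog2 B).trace := by
  obtain ⟨U, hU, a, rfl⟩ := hA.exists_eq_conj_realDiag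
  obtain ⟨V, hV, b, rfl⟩ := hB.exists_eq_conj_realDiag
  have hW : U ⊗ₖ V ∈ unitary (Matrix (P × Q) (P × Q) ℂ) := Matrix.kronecker_mem_unitary hU hV
  rw [kronecker_conj_realDiag, supportLE_conj_realDiag_iff hρ hW] at hs
  rw [← trace_mul_kronecker_one, ← trace_mul_one_kronecker, kronecker_conj_realDiag, matLog2,
    matLog2, matLog2, hermCFC_conj_realDiag _ hW, hermCFC_conj_realDiag _ hU,
    hermCFC_conj_realDiag _ hV]
  have h1 := one_eq_conj_realDiag hU
  have h2 := one_eq_conj_realDiag hV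
  rw [h1, h2, kronecker_conj_realDiag, kronecker_conj_realDiag, trace_mul_conj_realDiag,
    trace_mul_conj_realDiag, trace_mul_conj_realDiag, ← Finset.sum_add_distrib]
  refine Finset.sum_congr rfl fun x _ => ?_
  by_cases hx : a x.1 * b x.2 = 0
  · simp [hs x hx]
  · obtain ⟨ha, hb⟩ := mul_ne_zero_iff.mp hx
    simp only [Function.comp_apply, Real.logb_mul ha hb, mul_one, one_mul, Complex.ofReal_add,
      mul_add]

lemma supportLE_kronecker_marginals {ρ : Matrix (P × Q) (P × Q) ℂ} (hρ : ρ.PosSemidef) :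
    SupportLE ρ (ptrace2 ρ ⊗ₖ ptrace1 ρ) := by
  obtain ⟨U, hU, a, hA⟩ := hρ.ptrace2.isHermitian.exists_eq_conj_realDiag
  obtain ⟨V, hV, b, hB⟩ := hρ.ptrace1.isHermitian.exists_eq_conj_realDiag
  have hW : U ⊗ₖ V ∈ unitary (Matrix (P × Q) (P × Q) ℂ) := Matrix.kronecker_mem_unitary hU hV
  have hN := hρ.conjTranspose_mul_mul_same (U ⊗ₖ V)
  have hpos : ∀ x, 0 ≤ ((U ⊗ₖ V)ᴴ * ρ * (U ⊗ₖ V)) x x := fun x => hN.diag_nonneg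
  have h1 := one_eq_conj_realDiag hU
  have h2 := one_eq_conj_realDiag hV
  have ha : ∀ x : P, (a x : ℂ) = ∑ y, ((U ⊗ₖ V)ᴴ * ρ * (U ⊗ₖ V)) (x, y) (x, y) := by
    intro x
    have h := trace_mul_kronecker_one ρ (U * realDiag (Pi.single x 1) * Uᴴ)
    rw [h2, kronecker_conj_realDiag, trace_mul_conj_realDiag, trace_mul_conj_realDiag, hA,
      conjTranspose_mul_conj_mul hU, Fintype.sum_prod_type] at h
    simpa [Pi.single_apply, apply_ite Complex.ofReal, Finset.sum_ite_irrel] using h.symm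
  have hb : ∀ y : Q, (b y : ℂ) = ∑ x, ((U ⊗ₖ V)ᴴ * ρ * (U ⊗ₖ V)) (x, y) (x, y) := by
    intro y
    have h := trace_mul_one_kronecker ρ (V * realDiag (Pi.single y 1) * Vᴴ)
    rw [h1, kronecker_conj_realDiag, trace_mul_conj_realDiag, trace_mul_conj_realDiag, hB,
      conjTranspose_mul_conj_mul hV, Fintype.sum_prod_type] at h
    simpa [Pi.single_apply, apply_ite Complex.ofReal] using h.symm
  rw [hA, hB, kronecker_conj_realDiag, supportLE_conj_realDiag_iff hρ hW]
  rintro ⟨x, y⟩ hxy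
  rcases mul_eq_zero.mp hxy with h | h
  · have := ha x
    rw [show a x = 0 from h, Complex.ofReal_zero] at this
    exact (Finset.sum_eq_zero_iff_of_nonneg fun y _ => hpos (x, y)).mp this.symm y
      (Finset.mem_univ y)
  · have := hb y
    rw [show b y = 0 from h, Complex.ofReal_zero] at this
    exact (Finset.sum_eq_zero_iff_of_nonneg fun x _ => hpos (x, y)).mp this.symm x
      (Finset.mem_univ x)

lemma SupportLE.ptrace1 {P Q : Type*} [Fintype P] [Fintype Q]
    {ρ : Matrix (P × Q) (P × Q) ℂ} {A : Matrix P P ℂ} {B : Matrix Q Q ℂ}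
    (hs : SupportLE ρ (A ⊗ₖ B)) : SupportLE (_root_.ptrace1 ρ) B := by
  intro v hv
  have h : ∀ k : P, ρ *ᵥ (fun x => (Pi.single k 1 : P → ℂ) x.1 * v x.2) = 0 := by
    intro k
    apply hs
    ext ⟨i, j⟩
    have hj := congrFun hv j
    rw [Matrix.mulVec, dotProduct, Pi.zero_apply] at hj
    simp only [Matrix.mulVec, dotProduct, Fintype.sum_prod_type, Matrix.kroneckerMap_apply,
      Pi.zero_apply]
    refine Finset.sum_eq_zero fun i' _ => ?_
    rw [← mul_zero (A i i' * (Pi.single k 1 : P → ℂ) i'), ← hj, Finset.mul_sum]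
    exact Finset.sum_congr rfl fun j' _ => mul_mul_mul_comm _ _ _ _
  ext j
  simp only [Matrix.mulVec, dotProduct, _root_.ptrace1, Finset.sum_mul, Pi.zero_apply]
  rw [Finset.sum_comm]
  refine Finset.sum_eq_zero fun k _ => ?_
  simpa [Matrix.mulVec, dotProduct, Fintype.sum_prod_type, Pi.single_apply] using
    congrFun (h k) (k, j)

/-- `I(P:Q)_ρ = D(ρ_PQ ‖ ρ_P ⊗ σ_Q) - D(ρ_Q ‖ σ_Q)`. -/
lemma relentR_kronecker_marginals {ρ : Matrix (P × Q) (P × Q) ℂ} (hρ : ρ.PosSemidef)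
    {σ : Matrix Q Q ℂ} (hσ : σ.IsHermitian) (hs : SupportLE ρ (ptrace2 ρ ⊗ₖ σ)) :
    relentR ρ (ptrace2 ρ ⊗ₖ ptrace1 ρ) =
      relentR ρ (ptrace2 ρ ⊗ₖ σ) - relentR (ptrace1 ρ) σ := by
  simp only [relentR]
  rw [trace_mul_matLog2_kronecker hρ hρ.ptrace2.isHermitian hρ.ptrace1.isHermitian
      (supportLE_kronecker_marginals hρ),
    trace_mul_matLog2_kronecker hρ hρ.ptrace2.isHermitian hσ hs, ← Complex.sub_re]
  congr 1
  ring

end PartialTrace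

/-- Mutual information is bounded by the max-relative entropy:
I(P:Q)_ρ ≤ Dmax(ρ_PQ ‖ ρ_P ⊗ σ_Q). -/
theorem mutInfo_le_dmax {P Q : Type} [Fintype P] [Fintype Q]
    [DecidableEq P] [DecidableEq Q] [Nonempty P] [Nonempty Q]
    (ρ : Matrix (P × Q) (P × Q) ℂ) (hρ : IsDensityMatrix ρ)
    (σ : Matrix Q Q ℂ) (hσ : IsDensityMatrix σ)
    (hfin : dmax ρ (ptrace2 ρ ⊗ₖ σ) ≠ ⊤) :
    mutInfo ρ ≤ dmax ρ (ptrace2 ρ ⊗ₖ σ) := by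
  refine le_sInf ?_
  rintro _ ⟨l, rfl, hl⟩
  have hs := hl.supportLE hρ.1
  rw [mutInfo, relent, if_pos (supportLE_kronecker_marginals hρ.1), EReal.coe_le_coe_iff,
    relentR_kronecker_marginals hρ.1 hσ.1.isHermitian hs]
  have h1 := relentR_le_of_loewnerLE hρ (hρ.1.ptrace2.kronecker hσ.1) hl
  have h2 := relentR_nonneg hρ.ptrace1 hσ hs.ptrace1
  linarith

end
end
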